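/- (Lemma 2, differential passivity of the closed-loop variational error dynamics.) Let n ∈ ℕ and β > 0. Let M : ℝ → (n×n real matrices) be differentiable with M(t) symmetric positive definite for all t; let S : ℝ → (n×n real matrices) with S(t) skew-symmetric; let D : ℝ → (n×n real matrices) with D(t) symmetric positive semidefinite; let K_d be a symmetric positive semidefinite n×n matrix; let Π : ℝ → (n×n real matrices) be differentiable with Π(t) symmetric positive definite; and let A : ℝ → (n×n real matrices) satisfy ⟨z, (Π'(t) − Π(t) A(t) − A(t)ᵀ Π(t)) z⟩ ≤ −2β ⟨z, Π(t) z⟩ for all z ∈ ℝⁿ and all t. Suppose δq, δσ : ℝ → ℝⁿ are differentiable and δω : ℝ → ℝⁿ is such that, for all t, δq'(t) = −A(t) δq(t) + M(t)⁻¹ δσ(t) and δσ'(t) = −Π(t) δq(t) − (S(t) − (1/2) M'(t) + D(t) + K_d) M(t)⁻¹ δσ(t) + δω(t). Then V(t) := (1/2)⟨δq(t), Π(t) δq(t)⟩ + (1/2)⟨δσ(t), M(t)⁻¹ δσ(t)⟩ satisfies V'(t) ≤ ⟨M(t)⁻¹ δσ(t), δω(t)⟩ for all t. -/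

import Mathlib

open Matrix

section InverseDerivative

attribute [local instance] Matrix.linftyOpNormedRing Matrix.linftyOpNormedAlgebra

/-- The derivative of the inverse of a differentiable family of invertible matrices, entrywise. -/
theorem hasDerivAt_matrix_inv_apply {n : Type*} [Fintype n] [DecidableEq n]
    {M : ℝ → Matrix n n ℝ} {M' : Matrix n n ℝ} {t : ℝ}
    (hM : ∀ i j, HasDerivAt (fun s => M s i j) (M' i j) t) (hunit : IsUnit (M t)) (i j : n) :
    HasDerivAt (fun s => (M s)⁻¹ i j) ((-((M t)⁻¹ * M' * (M t)⁻¹)) i j) t := by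
  have hM_matrix : HasDerivAt M M' t :=
    hasDerivAt_pi.2 fun i => hasDerivAt_pi.2 fun j => hM i j
  obtain ⟨u, hu⟩ := hunit
  have hinv := hasFDerivAt_ringInverse (𝕜 := ℝ) u
  rw [hu] at hinv
  have hcomp := hinv.comp_hasDerivAt t hM_matrix
  have hentry := hasDerivAt_pi.1 (hasDerivAt_pi.1 hcomp i) j
  have huinv : (↑u⁻¹ : Matrix n n ℝ) = (M t)⁻¹ := by rw [← hu, Matrix.coe_units_inv]
  simpa [Function.comp_def, ← Matrix.nonsing_inv_eq_ringInverse, huinv] using hentry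

end InverseDerivative

/-- The product rule for a time-varying quadratic form. -/
theorem hasDerivAt_dotProduct_mulVec {n : Type*} [Fintype n]
    {P : ℝ → Matrix n n ℝ} {P' : Matrix n n ℝ} {u : ℝ → n → ℝ} {u' : n → ℝ} {t : ℝ}
    (hP : ∀ i j, HasDerivAt (fun s => P s i j) (P' i j) t) (hu : HasDerivAt u u' t) :
    HasDerivAt (fun s => u s ⬝ᵥ P s *ᵥ u s)
      (u' ⬝ᵥ P t *ᵥ u t + u t ⬝ᵥ P' *ᵥ u t + u t ⬝ᵥ P t *ᵥ u') t := by
  have hentry := hasDerivAt_pi.1 hu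
  have hsum := HasDerivAt.fun_sum (u := Finset.univ) fun i _ =>
    (hentry i).fun_mul (HasDerivAt.fun_sum (u := Finset.univ) fun j _ =>
      (hP i j).fun_mul (hentry j))
  refine hsum.congr_deriv ?_
  simp only [dotProduct, mulVec, Finset.sum_add_distrib, mul_add, add_assoc]

/-- A symmetric matrix can be moved across the dot product. -/
theorem dotProduct_mulVec_comm_of_transpose_eq {n R : Type*} [Fintype n] [CommRing R]
    {P : Matrix n n R} (hP : Pᵀ = P) (u v : n → R) : u ⬝ᵥ P *ᵥ v = v ⬝ᵥ P *ᵥ u := by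
  rw [dotProduct_mulVec, ← mulVec_transpose, hP, dotProduct_comm]

/-- The quadratic form of a skew-symmetric real matrix vanishes. -/
theorem dotProduct_mulVec_self_of_transpose_eq_neg {n : Type*} [Fintype n]
    {S : Matrix n n ℝ} (hS : Sᵀ = -S) (u : n → ℝ) : u ⬝ᵥ S *ᵥ u = 0 := by
  have h : u ⬝ᵥ S *ᵥ u = -(u ⬝ᵥ S *ᵥ u) := by
    conv_lhs => rw [dotProduct_mulVec, ← mulVec_transpose, hS, dotProduct_comm]
    rw [neg_mulVec, dotProduct_neg]
  linarith

/-- Lemma 2: differential passivity of the closed-loop variational error dynamics of the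
fully actuated mechanical pH system, with differential storage
`V = (1/2)δqᵀΠδq + (1/2)δσᵀM⁻¹δσ` and output `δy = M⁻¹δσ`. -/
theorem stmt_9 (n : ℕ) (β : ℝ) (hβ : 0 < β)
    (M M' : ℝ → Matrix (Fin n) (Fin n) ℝ)
    (hMdiff : ∀ t i j, HasDerivAt (fun s => M s i j) (M' t i j) t)
    (hMsymm : ∀ t, (M t)ᵀ = M t)
    (hMpos : ∀ t (z : Fin n → ℝ), z ≠ 0 → 0 < z ⬝ᵥ (M t).mulVec z)
    (S : ℝ → Matrix (Fin n) (Fin n) ℝ) (hS : ∀ t, (S t)ᵀ = -(S t))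
    (D : ℝ → Matrix (Fin n) (Fin n) ℝ) (hDsymm : ∀ t, (D t)ᵀ = D t)
    (hDpos : ∀ t (z : Fin n → ℝ), 0 ≤ z ⬝ᵥ (D t).mulVec z)
    (Kd : Matrix (Fin n) (Fin n) ℝ) (hKdsymm : Kdᵀ = Kd)
    (hKdpos : ∀ z : Fin n → ℝ, 0 ≤ z ⬝ᵥ Kd.mulVec z)
    (Pm Pm' : ℝ → Matrix (Fin n) (Fin n) ℝ)
    (hPmdiff : ∀ t i j, HasDerivAt (fun s => Pm s i j) (Pm' t i j) t)
    (hPmsymm : ∀ t, (Pm t)ᵀ = Pm t)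
    (hPmpos : ∀ t (z : Fin n → ℝ), z ≠ 0 → 0 < z ⬝ᵥ (Pm t).mulVec z)
    (A : ℝ → Matrix (Fin n) (Fin n) ℝ)
    (hA : ∀ t (z : Fin n → ℝ),
      z ⬝ᵥ (Pm' t - Pm t * A t - (A t)ᵀ * Pm t).mulVec z ≤
        -(2 * β) * (z ⬝ᵥ (Pm t).mulVec z))
    (δq δσ : ℝ → Fin n → ℝ) (δω : ℝ → Fin n → ℝ)
    (hδq : ∀ t, HasDerivAt δq (-(A t).mulVec (δq t) + (M t)⁻¹.mulVec (δσ t)) t)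
    (hδσ : ∀ t, HasDerivAt δσ
      (-(Pm t).mulVec (δq t)
        - (S t - (1 / 2 : ℝ) • M' t + D t + Kd).mulVec ((M t)⁻¹.mulVec (δσ t))
        + δω t) t)
    (V : ℝ → ℝ)
    (hV : V = fun t => (1 / 2 : ℝ) * (δq t ⬝ᵥ (Pm t).mulVec (δq t))
      + (1 / 2 : ℝ) * (δσ t ⬝ᵥ (M t)⁻¹.mulVec (δσ t))) :
    ∀ t, DifferentiableAt ℝ V t ∧ deriv V t ≤ (M t)⁻¹.mulVec (δσ t) ⬝ᵥ δω t := by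
  intro t
  have hMpd : (M t).PosDef :=
    .of_dotProduct_mulVec_pos (hMsymm t) fun z hz => by simpa using hMpos t z hz
  have hinv_symm : ((M t)⁻¹)ᵀ = (M t)⁻¹ := by rw [transpose_nonsing_inv, hMsymm]
  have hderiv := ((hasDerivAt_dotProduct_mulVec (hPmdiff t) (hδq t)).const_mul (1 / 2 : ℝ)).fun_add
    ((hasDerivAt_dotProduct_mulVec (hasDerivAt_matrix_inv_apply (hMdiff t) hMpd.isUnit)
      (hδσ t)).const_mul (1 / 2 : ℝ))
  rw [← hV] at hderiv
  refine ⟨hderiv.differentiableAt, ?_⟩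
  rw [hderiv.deriv, dotProduct_mulVec_comm_of_transpose_eq hinv_symm (δσ t),
    dotProduct_mulVec_comm_of_transpose_eq (hPmsymm t) (δq t) (_ + _)]
  have hinv_deriv : δσ t ⬝ᵥ (-((M t)⁻¹ * M' t * (M t)⁻¹)) *ᵥ δσ t =
      -((M t)⁻¹ *ᵥ δσ t ⬝ᵥ M' t *ᵥ ((M t)⁻¹ *ᵥ δσ t)) := by
    rw [neg_mulVec, dotProduct_neg, ← mulVec_mulVec, ← mulVec_mulVec, dotProduct_mulVec,
      ← mulVec_transpose, hinv_symm]
  rw [hinv_deriv]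
  generalize (M t)⁻¹ *ᵥ δσ t = y
  have hcontr := hA t (δq t)
  have hPA : δq t ⬝ᵥ (Pm t * A t) *ᵥ δq t = A t *ᵥ δq t ⬝ᵥ Pm t *ᵥ δq t := by
    rw [← mulVec_mulVec, dotProduct_mulVec_comm_of_transpose_eq (hPmsymm t)]
  have hAP : δq t ⬝ᵥ ((A t)ᵀ * Pm t) *ᵥ δq t = A t *ᵥ δq t ⬝ᵥ Pm t *ᵥ δq t := by
    rw [← mulVec_mulVec, dotProduct_mulVec, ← mulVec_transpose, transpose_transpose]
  have hPnonneg : 0 ≤ δq t ⬝ᵥ Pm t *ᵥ δq t := by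
    rcases eq_or_ne (δq t) 0 with h | h
    · simp [h]
    · exact (hPmpos t _ h).le
  have hβP := mul_nonneg hβ.le hPnonneg
  have hSy := dotProduct_mulVec_self_of_transpose_eq_neg (hS t) y
  have hDy := hDpos t y
  have hKy := hKdpos y
  simp only [sub_mulVec, dotProduct_sub, hPA, hAP] at hcontr
  rw [dotProduct_comm _ y]
  simp only [add_dotProduct, neg_dotProduct, dotProduct_add, dotProduct_sub, dotProduct_neg,
    add_mulVec, sub_mulVec, smul_mulVec, dotProduct_smul, smul_eq_mul]
  linarith
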